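/- (UBT for ASP, lower h-range.) Let P ∈ P(d,n,s) with ASP-pair (P,F), and let P' be the complex of all proper faces of P except F. Then for every 0 ≤ k ≤ ⌊(d−1)/2⌋, h_k(P') ≤ C(n−d−1+k, k), where C(a,b) denotes the binomial coefficient. -/

import Mathlib

open Finset

namespace ASP

noncomputable section

/-- The dot product of two vectors in `ℝ^d`. -/
def dotp {d : ℕ} (x y : Fin d → ℝ) : ℝ := ∑ i, x i * y i

/-- `F` is a face of the polytope `P ⊆ ℝ^d`: the intersection of `P` with a supporting
hyperplane, together with the empty face and `P` itself. -/
def IsFaceOf {d : ℕ} (P F : Set (Fin d → ℝ)) : Prop :=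
  F = ∅ ∨ F = P ∨
    ∃ (b : Fin d → ℝ) (c : ℝ), b ≠ 0 ∧ (∀ x ∈ P, dotp b x ≤ c) ∧
      F = {x ∈ P | dotp b x = c}

/-- The dimension of a subset of `ℝ^d`: the dimension of its affine span. -/
def polyDim {d : ℕ} (S : Set (Fin d → ℝ)) : ℕ :=
  Module.finrank ℝ (affineSpan ℝ S).direction

/-- A polytope: the convex hull of a finite point set. -/
def IsPolytope {d : ℕ} (P : Set (Fin d → ℝ)) : Prop :=
  ∃ V : Finset (Fin d → ℝ), P = convexHull ℝ (V : Set (Fin d → ℝ))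

/-- The vertex set of a polytope: its set of extreme points. -/
def verts {d : ℕ} (P : Set (Fin d → ℝ)) : Set (Fin d → ℝ) :=
  Set.extremePoints ℝ P

/-- `fVec P i` is the number of `i`-dimensional (nonempty) faces of `P`. -/
def fVec {d : ℕ} (P : Set (Fin d → ℝ)) (i : ℕ) : ℕ :=
  {F : Set (Fin d → ℝ) | IsFaceOf P F ∧ F.Nonempty ∧ polyDim F = i}.ncard

/-- A facet of a `d`-polytope in `ℝ^d`: a `(d-1)`-dimensional face. -/
def IsFacetOf {d : ℕ} (P F : Set (Fin d → ℝ)) : Prop :=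
  IsFaceOf P F ∧ F.Nonempty ∧ polyDim F = d - 1

/-- `(P, F)` is an ASP-pair: `P` is a `d`-polytope, `F` is a facet of `P`, and every facet
of `P` other than `F` is a simplex (i.e. has exactly `d` vertices). -/
def IsASPPair {d : ℕ} (P F : Set (Fin d → ℝ)) : Prop :=
  IsPolytope P ∧ polyDim P = d ∧ IsFacetOf P F ∧
    ∀ G, IsFacetOf P G → G ≠ F → (verts G).ncard = d

/-- `P ∈ 𝒫(d,n,s)`: `P` is a `d`-polytope with `n` vertices such that `(P,F)` is an
ASP-pair where the facet `F` has `d + s` vertices. -/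
def MemASP (d n s : ℕ) (P : Set (Fin d → ℝ)) : Prop :=
  (verts P).ncard = n ∧ ∃ F, IsASPPair P F ∧ (verts F).ncard = d + s

/-- `fBall P i` is `f_{i-1}(P')` of the simplicial ball `P' = ∂P - {F}` consisting of all
proper faces of `P` except its (unique non-simplex) facet `F`; the index is shifted by one,
so `fBall P 0 = f_{-1} = 1` counts the empty face, and at the top dimension the facet `F`
is discarded. -/
def fBall {d : ℕ} (P : Set (Fin d → ℝ)) (i : ℕ) : ℤ :=
  if i = 0 then 1
  else if i = d then (fVec P (d - 1) : ℤ) - 1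
  else if d < i then 0
  else (fVec P (i - 1) : ℤ)

/-- `hBall P k` is `h_k(P')` of the `(d-1)`-dimensional ball `P' = ∂P - {F}`, defined by
`h_k = ∑_{i=0}^{k} (-1)^{k-i} C(d-i, k-i) f_{i-1}(P')`, extended by `0` outside `0 ≤ k ≤ d`. -/
def hBall {d : ℕ} (P : Set (Fin d → ℝ)) (k : ℤ) : ℤ :=
  if 0 ≤ k ∧ k ≤ (d : ℤ) then
    ∑ i ∈ Finset.range (k.toNat + 1),
      (-1) ^ (k.toNat - i) * ((d - i).choose (k.toNat - i) : ℤ) * fBall P i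
  else 0

/-- `fBd m Q i` is `f_{i-1}(∂Q)` of the boundary complex of an `m`-polytope `Q ⊆ ℝ^d`
(a complex of dimension `m - 1`); the index is shifted by one. -/
def fBd {d : ℕ} (m : ℕ) (Q : Set (Fin d → ℝ)) (i : ℕ) : ℤ :=
  if i = 0 then 1 else if m + 1 ≤ i then 0 else (fVec Q (i - 1) : ℤ)

/-- `hBd m Q k` is `h_k(∂Q)` for the boundary complex of an `m`-polytope `Q ⊆ ℝ^d`, defined by
`h_k = ∑_{i=0}^{k} (-1)^{k-i} C(m-i, k-i) f_{i-1}(∂Q)`, extended by `0` outside `0 ≤ k ≤ m`. -/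
def hBd {d : ℕ} (m : ℕ) (Q : Set (Fin d → ℝ)) (k : ℤ) : ℤ :=
  if 0 ≤ k ∧ k ≤ (m : ℤ) then
    ∑ i ∈ Finset.range (k.toNat + 1),
      (-1) ^ (k.toNat - i) * ((m - i).choose (k.toNat - i) : ℤ) * fBd m Q i
  else 0

/-- `gBd m Q k = g_k(∂Q) = h_k(∂Q) - h_{k-1}(∂Q)`. -/
def gBd {d : ℕ} (m : ℕ) (Q : Set (Fin d → ℝ)) (k : ℤ) : ℤ :=
  hBd m Q k - hBd m Q (k - 1)

/-- The function `p(t) = (n-1)^{(t-1)(d-1)} · t(t+1)⋯(t+d+s-1)` (real exponentiation of the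
positive base `n-1`) used to define the almost cyclic polytope. -/
def acp (d n s : ℕ) (t : ℝ) : ℝ :=
  ((n : ℝ) - 1) ^ ((t - 1) * ((d : ℝ) - 1)) * ∏ l ∈ Finset.range (d + s), (t + l)

/-- The curve `y(t) = (t, t², …, t^{d-1}, p(t)) ∈ ℝ^d`. -/
def acy (d n s : ℕ) (t : ℝ) : Fin d → ℝ :=
  fun i => if (i : ℕ) + 1 = d then acp d n s t else t ^ ((i : ℕ) + 1)

/-- The parameter values `t_i = -s - d + i` for `i = 1, …, n` (here `0`-indexed:
`acT d s j = t_{j+1}`). -/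
def acT (d s j : ℕ) : ℝ := (j : ℝ) + 1 - s - d

/-- The `n` points `y(t_1), …, y(t_n)` on the curve `y` (`0`-indexed). -/
def acPoint (d n s : ℕ) (j : Fin n) : Fin d → ℝ := acy d n s (acT d s (j : ℕ))

/-- The almost cyclic polytope `C(d,n,s) = conv{y(t_1), …, y(t_n)}`. -/
def acPolytope (d n s : ℕ) : Set (Fin d → ℝ) :=
  convexHull ℝ (Set.range (acPoint d n s))

/-- The non-simplex facet `F = conv{y(t_1), …, y(t_{d+s})}` of the almost cyclic polytope. -/
def acFacet (d n s : ℕ) : Set (Fin d → ℝ) :=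
  convexHull ℝ (acPoint d n s '' {j : Fin n | (j : ℕ) < d + s})

/-- The generalized moment curve
`x(t) = (t, t², …, t^{d-r}, p_1(t), …, p_r(t)) ∈ ℝ^d`. -/
def gmc (d r : ℕ) (p : Fin r → ℝ → ℝ) (t : ℝ) : Fin d → ℝ :=
  fun i =>
    if h : (i : ℕ) < d - r then t ^ ((i : ℕ) + 1)
    else p ⟨(i : ℕ) - (d - r), by have h2 := i.2; omega⟩ t

/-- A polytope is `k`-neighborly if each subset of at most `k` of its vertices is the
vertex set of a face. -/
def IsNeighborly {d : ℕ} (k : ℕ) (P : Set (Fin d → ℝ)) : Prop :=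
  ∀ S : Finset (Fin d → ℝ), (S : Set (Fin d → ℝ)) ⊆ verts P → S.card ≤ k →
    ∃ G : Set (Fin d → ℝ), IsFaceOf P G ∧ verts G = (S : Set (Fin d → ℝ))

/-- The point `y` is beyond the facet `F` of the polytope `P`: for every supporting
hyperplane of `P` cutting out a facet, `y` is strictly on the outer side if the facet is `F`,
and strictly on the inner side otherwise. -/
def IsBeyond {d : ℕ} (P F : Set (Fin d → ℝ)) (y : Fin d → ℝ) : Prop :=
  ∀ (b : Fin d → ℝ) (c : ℝ), b ≠ 0 → (∀ x ∈ P, dotp b x ≤ c) →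
    IsFacetOf P {x ∈ P | dotp b x = c} →
      (({x ∈ P | dotp b x = c} = F → c < dotp b y) ∧
       ({x ∈ P | dotp b x = c} ≠ F → dotp b y < c))



set_option linter.unusedSectionVars false
section Alg
open MvPolynomial

variable {V : Type} [Fintype V] [DecidableEq V] {d : ℕ}

def rest (G : Finset V) : MvPolynomial V ℝ →ₐ[ℝ] MvPolynomial V ℝ :=
  aeval (fun v => if v ∈ G then X v else 0)

def ee (R : Finset V) : V →₀ ℕ := ∑ v ∈ R, Finsupp.single v 1

def xR (R : Finset V) : MvPolynomial V ℝ := ∏ v ∈ R, X v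

lemma xR_eq (R : Finset V) : xR R = monomial (ee R) 1 := by
  unfold xR ee
  rw [monomial_sum_one]; rfl

lemma ee_apply (R : Finset V) (v : V) : ee R v = if v ∈ R then 1 else 0 := by
  unfold ee
  simp [Finsupp.finsetSum_apply, Finsupp.single_apply]

lemma ee_le (R : Finset V) (m : V →₀ ℕ) (h : R ⊆ m.support) : ee R ≤ m := by
  intro v
  rw [ee_apply]
  split_ifs with hv
  · have := Finsupp.mem_support_iff.1 (h hv)
    omega
  · omega

lemma rest_monomial (G : Finset V) (m : V →₀ ℕ) (c : ℝ) :
    rest G (monomial m c) = if m.support ⊆ G then monomial m c else 0 := by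
  unfold rest
  rw [aeval_monomial]
  split_ifs with h
  · rw [monomial_eq]
    congr 1
    apply Finset.prod_congr rfl
    intro v hv
    simp [h hv]
  · obtain ⟨v, hv, hvG⟩ := Finset.not_subset.1 h
    have : (m.prod fun i k => (if i ∈ G then (X i : MvPolynomial V ℝ) else 0) ^ k) = 0 := by
      apply Finset.prod_eq_zero hv
      simp [hvG, Finsupp.mem_support_iff.1 hv]
    rw [this, mul_zero]

lemma coeff_rest (G : Finset V) (f : MvPolynomial V ℝ) (m : V →₀ ℕ) :
    coeff m (rest G f) = if m.support ⊆ G then coeff m f else 0 := by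
  induction f using MvPolynomial.induction_on' with
  | monomial u a =>
    rw [rest_monomial]
    by_cases h : u = m
    · subst h
      split_ifs <;> simp
    · split_ifs <;> simp [coeff_monomial, h]
  | add p q hp hq =>
    rw [map_add, coeff_add, hp, hq]
    split_ifs <;> simp

lemma rest_X (G : Finset V) (v : V) : rest G (X v) = if v ∈ G then X v else 0 := by
  simp [rest]

lemma rest_xR (G R : Finset V) : rest G (xR R) = if R ⊆ G then xR R else 0 := by
  unfold xR
  rw [map_prod]
  split_ifs with h
  · apply Finset.prod_congr rfl
    intro v hv
    rw [rest_X, if_pos (h hv)]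
  · obtain ⟨v, hv, hvG⟩ := Finset.not_subset.1 h
    apply Finset.prod_eq_zero hv
    rw [rest_X, if_neg hvG]

lemma rest_rest (G : Finset V) (f : MvPolynomial V ℝ) : rest G (rest G f) = rest G f := by
  ext m
  rw [coeff_rest, coeff_rest]
  split_ifs <;> rfl

lemma xR_ne (R : Finset V) : xR R ≠ 0 := by
  rw [xR_eq]; simp

def th (y : V → Fin d → ℝ) (j : Fin d) : MvPolynomial V ℝ := ∑ v, C (y v j) * X v

def Th (y : V → Fin d → ℝ) : MvPolynomial (Fin d) ℝ →ₐ[ℝ] MvPolynomial V ℝ := aeval (th y)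

lemma sum_th (y : V → Fin d → ℝ) (a : Fin d → ℝ) :
    ∑ j, C (a j) * th y j = ∑ v, C (a ⬝ᵥ y v) * X v := by
  unfold th dotProduct
  simp_rw [Finset.mul_sum, map_sum, Finset.sum_mul]
  rw [Finset.sum_comm]
  simp [mul_assoc]

/-- substitution inverse on `G` -/
def psi (G : Finset V) (a : V → Fin d → ℝ) : MvPolynomial V ℝ →ₐ[ℝ] MvPolynomial (Fin d) ℝ :=
  aeval (fun v => if v ∈ G then ∑ j, C (a v j) * X j else 0)

lemma exists_g (y : V → Fin d → ℝ) (G : Finset V) (a : V → Fin d → ℝ)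
    (h1 : ∀ v ∈ G, ∀ w ∈ G, a v ⬝ᵥ y w = if v = w then 1 else 0) (h : MvPolynomial V ℝ) :
    rest G (Th y (psi G a h)) = rest G h := by
  have : ((rest G).comp (Th y)).comp (psi G a) = rest G := by
    apply MvPolynomial.algHom_ext
    intro v
    simp only [AlgHom.comp_apply, rest_X]
    unfold psi
    rw [aeval_X]
    split_ifs with hv
    · have e : (Th y) (∑ j, C (a v j) * X j) = ∑ j, C (a v j) * th y j := by
        simp [Th, MvPolynomial.algHom_C]
      rw [e, sum_th, map_sum]
      simp only [map_mul, rest_X, MvPolynomial.algHom_C, MvPolynomial.algebraMap_eq]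
      rw [Finset.sum_eq_single v]
      · simp [hv, h1 v hv v hv]
      · intro w _ hw
        split_ifs with hwG
        · rw [h1 v hv w hwG, if_neg (Ne.symm hw)]; simp
        · simp
      · simp
    · simp
  exact DFunLike.congr_fun this h

lemma psi_Th (y : V → Fin d → ℝ) (G : Finset V) (a : V → Fin d → ℝ)
    (h2 : ∀ c : Fin d → ℝ, ∑ v ∈ G, (a v ⬝ᵥ c) • y v = c) (g : MvPolynomial (Fin d) ℝ) :
    psi G a (rest G (Th y g)) = g := by
  have : ((psi G a).comp (rest G)).comp (Th y) = AlgHom.id ℝ _ := by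
    apply MvPolynomial.algHom_ext
    intro j
    simp only [AlgHom.comp_apply, AlgHom.id_apply]
    unfold Th
    rw [aeval_X]
    unfold th
    simp only [map_sum, map_mul, rest_X, MvPolynomial.algHom_C, MvPolynomial.algebraMap_eq]
    have e : ∀ v, (psi G a) (if v ∈ G then X v else 0)
        = if v ∈ G then ∑ j, C (a v j) * X j else 0 := by
      intro v
      split_ifs with hv
      · simp [psi, hv]
      · simp
    simp only [e, mul_ite, mul_zero]
    rw [Finset.sum_ite_mem, Finset.univ_inter]
    simp_rw [Finset.mul_sum]
    rw [Finset.sum_comm]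
    have e2 : ∀ l, ∑ v ∈ G, (C (y v j) * (C (a v l) * X l) : MvPolynomial (Fin d) ℝ)
        = C (if l = j then 1 else 0) * X l := by
      intro l
      have := congr_fun (h2 (Pi.single l 1)) j
      simp only [Finset.sum_apply, Pi.smul_apply, smul_eq_mul, dotProduct_single, mul_one] at this
      rw [Pi.single_apply] at this
      have h3 : (if l = j then (1:ℝ) else 0) = if j = l then 1 else 0 := by simp [eq_comm]
      rw [h3, ← this, map_sum, Finset.sum_mul]
      apply Finset.sum_congr rfl
      intro v _
      rw [map_mul]; ring
    simp only [e2]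
    simp
  exact DFunLike.congr_fun this g

structure Shell (V : Type) [Fintype V] [DecidableEq V] (d : ℕ) where
  y : V → Fin d → ℝ
  𝒢 : Finset (Finset V)
  R : Finset V → Finset V
  val : Finset V → ℝ
  a : Finset V → V → Fin d → ℝ
  ne : 𝒢.Nonempty
  card : ∀ G ∈ 𝒢, G.card = d
  h1 : ∀ G ∈ 𝒢, ∀ v ∈ G, ∀ w ∈ G, a G v ⬝ᵥ y w = if v = w then 1 else 0
  h2 : ∀ G ∈ 𝒢, ∀ c : Fin d → ℝ, ∑ v ∈ G, (a G v ⬝ᵥ c) • y v = c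
  RG : ∀ G ∈ 𝒢, R G ⊆ G
  lt : ∀ G ∈ 𝒢, ∀ G' ∈ 𝒢, R G ⊆ G' → G ≠ G' → val G < val G'
  ex : ∀ G ∈ 𝒢, ∀ σ ⊆ G, ∃ G' ∈ 𝒢, R G' ⊆ σ ∧ σ ⊆ G'

variable (S : Shell V d)

lemma Shell.indep (g : Finset V → MvPolynomial (Fin d) ℝ)
    (h : ∀ G ∈ S.𝒢, rest G (∑ G' ∈ S.𝒢, xR (S.R G') * Th S.y (g G')) = 0) :
    ∀ G ∈ S.𝒢, g G = 0 := by
  by_contra hc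
  push Not at hc
  obtain ⟨G0, hG0, hg0⟩ := hc
  obtain ⟨G, hG, hmin⟩ := Finset.exists_min_image (S.𝒢.filter (fun G => g G ≠ 0)) S.val
    ⟨G0, by simp [hG0, hg0]⟩
  simp only [Finset.mem_filter] at hG hmin
  have := h G hG.1
  rw [map_sum, Finset.sum_eq_single G] at this
  · rw [map_mul, rest_xR, if_pos (S.RG G hG.1)] at this
    have h3 := (mul_eq_zero.1 this).resolve_left (xR_ne _)
    have h4 := psi_Th S.y G (S.a G) (S.h2 G hG.1) (g G)
    rw [h3, map_zero] at h4
    exact hG.2 h4.symm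
  · intro G' hG' hne
    by_cases hg : g G' = 0
    · simp [hg]
    · rw [map_mul, rest_xR, if_neg, zero_mul]
      intro hs
      exact absurd (S.lt G' hG' G hG.1 hs hne) (not_lt.2 (hmin G' ⟨hG', hg⟩))
  · intro hn; exact absurd hG.1 hn

lemma Shell.span (f : MvPolynomial V ℝ) :
    ∃ g : Finset V → MvPolynomial (Fin d) ℝ, ∀ G ∈ S.𝒢,
      rest G (f - ∑ G' ∈ S.𝒢, xR (S.R G') * Th S.y (g G')) = 0 := by
  suffices H : ∀ s : Finset (Finset V), s ⊆ S.𝒢 →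
      (∀ G ∈ s, ∀ G' ∈ S.𝒢, S.val G' < S.val G → G' ∈ s) →
      ∃ g : Finset V → MvPolynomial (Fin d) ℝ, ∀ G ∈ s,
      rest G (f - ∑ G' ∈ s, xR (S.R G') * Th S.y (g G')) = 0 from
    H S.𝒢 subset_rfl (fun _ _ G' h _ => h)
  intro s
  induction s using Finset.induction_on_max_value S.val with
  | empty => intro _ _; exact ⟨fun _ => 0, by simp⟩
  | insert G s hGs hmax ih =>
    intro hsub hdown
    have hG : G ∈ S.𝒢 := hsub (Finset.mem_insert_self _ _)
    have hsub' : s ⊆ S.𝒢 := fun x hx => hsub (Finset.mem_insert_of_mem hx)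
    obtain ⟨g, hg⟩ := ih hsub' (by
      intro A hA B hB hlt
      have := hdown A (Finset.mem_insert_of_mem hA) B hB hlt
      rcases Finset.mem_insert.1 this with h | h
      · subst h; exact absurd (hmax A hA) (not_le.2 hlt)
      · exact h)
    set f' := f - ∑ G' ∈ s, xR (S.R G') * Th S.y (g G') with hf'
    -- divisibility
    have hdiv : ∃ h, rest G f' = xR (S.R G) * h := by
      refine ⟨(rest G f').divMonomial (ee (S.R G)), ?_⟩
      have e := divMonomial_add_modMonomial (rest G f') (ee (S.R G))
      have hz : (rest G f').modMonomial (ee (S.R G)) = 0 := by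
        ext m
        rw [coeff_zero]
        by_cases hm : ee (S.R G) ≤ m
        · exact coeff_modMonomial_of_le _ hm
        · rw [coeff_modMonomial_of_not_le _ hm, coeff_rest]
          split_ifs with hsup
          · obtain ⟨G', hG', hR', hs'⟩ := S.ex G hG m.support hsup
            have hne : G' ≠ G := by
              rintro rfl
              exact hm (ee_le _ _ hR')
            have hlt := S.lt G' hG' G hG (hR'.trans hsup) hne
            have hmem := hdown G (Finset.mem_insert_self _ _) G' hG' hlt
            have hmem' : G' ∈ s := (Finset.mem_insert.1 hmem).resolve_left hne
            have := congrArg (coeff m) (hg G' hmem')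
            rw [coeff_rest, if_pos hs', coeff_zero] at this
            exact this
          · rfl
      rw [hz, add_zero] at e
      rw [xR_eq, e]
    obtain ⟨h, hh⟩ := hdiv
    refine ⟨Function.update g G (psi G (S.a G) h), ?_⟩
    have esum : f - ∑ G' ∈ insert G s, xR (S.R G') * Th S.y (Function.update g G (psi G (S.a G) h) G')
        = f' - xR (S.R G) * Th S.y (psi G (S.a G) h) := by
      rw [Finset.sum_insert hGs, Function.update_self, hf']
      have : ∑ G' ∈ s, xR (S.R G') * Th S.y (Function.update g G (psi G (S.a G) h) G')
        = ∑ G' ∈ s, xR (S.R G') * Th S.y (g G') := by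
        apply Finset.sum_congr rfl
        intro A hA
        rw [Function.update_of_ne]
        rintro rfl; exact hGs hA
      rw [this]; ring
    intro A hA
    rw [esum, map_sub, map_mul]
    rcases Finset.mem_insert.1 hA with rfl | hA'
    · rw [exists_g S.y A (S.a A) (S.h1 A hG), ← rest_rest A f', hh, map_mul, sub_self]
    · rw [hg A hA', rest_xR, if_neg]
      · simp
      · intro hs
        have hne : G ≠ A := by rintro rfl; exact hGs hA'
        exact absurd (S.lt G hG A (hsub' hA') hs hne) (not_lt.2 (hmax A hA'))

lemma Shell.indep_mod (c : Finset V → ℝ)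
    (h : ∑ G ∈ S.𝒢, c G • xR (S.R G) ∈ Ideal.span (Set.range (th S.y))) :
    ∀ G ∈ S.𝒢, c G = 0 := by
  obtain ⟨f, hf⟩ := (Ideal.mem_span_range_iff_exists_fun).1 h
  choose g hg using fun j => S.span (f j)
  have key := S.indep (fun G => C (c G) - ∑ j, X j * g j G) (by
    intro A hA
    have e : ∑ G' ∈ S.𝒢, xR (S.R G') * Th S.y (C (c G') - ∑ j, X j * g j G')
        = ∑ j, (f j - ∑ G' ∈ S.𝒢, xR (S.R G') * Th S.y (g j G')) * th S.y j := by
      simp only [sub_mul, Finset.sum_sub_distrib, hf]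
      simp only [map_sub, mul_sub, Finset.sum_sub_distrib]
      congr 1
      · apply Finset.sum_congr rfl
        intro G _
        rw [MvPolynomial.algHom_C, MvPolynomial.algebraMap_eq, mul_comm, C_mul']
      · simp only [map_sum, map_mul, Finset.mul_sum, Finset.sum_mul]
        rw [Finset.sum_comm]
        apply Finset.sum_congr rfl
        intro j _
        apply Finset.sum_congr rfl
        intro G _
        have : Th S.y (X j) = th S.y j := by simp [Th]
        rw [this]; ring
    rw [e, map_sum]
    apply Finset.sum_eq_zero
    intro j _
    rw [map_mul, hg j A hA, zero_mul])
  intro G hG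
  have := congrArg (coeff 0) (key G hG)
  simpa [coeff_sum, coeff_X_mul'] using this

lemma prod_mem_span {Q U : Type*} [CommRing Q] [Algebra ℝ Q] [DecidableEq U] (f : U → Q) (x : V → Q)
    (hx : ∀ v, x v ∈ Submodule.span ℝ (Set.range f)) (R : Finset V) (k : ℕ) (hk : R.card = k) :
    ∏ v ∈ R, x v ∈ Submodule.span ℝ
      (Set.range (fun m : Sym U k => ((m : Multiset U).map f).prod)) := by
  induction k generalizing R with
  | zero =>
    rw [Finset.card_eq_zero] at hk
    subst hk
    apply Submodule.subset_span
    exact ⟨Sym.nil, by simp⟩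
  | succ k ih =>
    obtain ⟨v, R', hv, rfl, hR'⟩ := Finset.card_eq_succ.1 hk
    rw [Finset.prod_insert hv]
    have h1 := ih R' hR'
    have h2 := hx v
    have h3 := Submodule.mul_mem_mul h2 h1
    rw [Submodule.span_mul_span] at h3
    refine Submodule.span_mono ?_ h3
    rintro _ ⟨_, ⟨u, rfl⟩, _, ⟨m, rfl⟩, rfl⟩
    exact ⟨Sym.cons u m, by simp [Sym.coe_cons]⟩

theorem Shell.bound (k : ℕ) :
    (S.𝒢.filter (fun G => (S.R G).card = k)).card ≤ (Fintype.card V - d - 1 + k).choose k := by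
  classical
  obtain ⟨G0, hG0⟩ := S.ne
  set I := Ideal.span (Set.range (th S.y)) with hI
  let Q := MvPolynomial V ℝ ⧸ I
  let mk : MvPolynomial V ℝ →ₐ[ℝ] Q := Ideal.Quotient.mkₐ ℝ I
  let U := {v : V // v ∉ G0}
  let f : U → Q := fun u => mk (X u.1)
  let x : V → Q := fun v => mk (X v)
  have hx : ∀ v, x v ∈ Submodule.span ℝ (Set.range f) := by
    intro v
    by_cases hv : v ∈ G0
    · have hmem : ∑ w, C (S.a G0 v ⬝ᵥ S.y w) * X w ∈ I := by
        rw [← sum_th]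
        apply Ideal.sum_mem
        intro j _
        exact Ideal.mul_mem_left _ _ (Ideal.subset_span ⟨j, rfl⟩)
      have hz : mk (∑ w, C (S.a G0 v ⬝ᵥ S.y w) * X w) = 0 := Ideal.Quotient.eq_zero_iff_mem.2 hmem
      rw [map_sum, ← Finset.sum_add_sum_compl G0] at hz
      have e1 : ∑ w ∈ G0, mk (C (S.a G0 v ⬝ᵥ S.y w) * X w) = x v := by
        rw [Finset.sum_eq_single v]
        · rw [S.h1 G0 hG0 v hv v hv]; simp [x]
        · intro w hw hne
          rw [S.h1 G0 hG0 v hv w hw, if_neg (Ne.symm hne)]; simp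
        · intro h; exact absurd hv h
      rw [e1] at hz
      rw [eq_neg_of_add_eq_zero_left hz]
      apply Submodule.neg_mem
      apply Submodule.sum_mem
      intro w hw
      rw [C_mul', map_smul]
      apply Submodule.smul_mem
      exact Submodule.subset_span ⟨⟨w, by simpa using hw⟩, rfl⟩
    · exact Submodule.subset_span ⟨⟨v, hv⟩, rfl⟩
  let T := S.𝒢.filter (fun G => (S.R G).card = k)
  have hli : LinearIndependent ℝ (fun G : T => mk (xR (S.R G.1))) := by
    rw [Fintype.linearIndependent_iff]
    intro c hc G
    have h1 := S.indep_mod (fun A => if h : A ∈ T then c ⟨A, h⟩ else 0) (by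
      rw [← Ideal.Quotient.eq_zero_iff_mem]
      change mk _ = 0
      rw [← hc, map_sum]
      have hT : T ⊆ S.𝒢 := Finset.filter_subset _ _
      rw [← Finset.sum_subset hT]
      · rw [← Finset.sum_attach]
        apply Finset.sum_congr rfl
        intro A _
        rw [dif_pos A.2, map_smul]
      · intro A _ hA
        rw [dif_neg hA]; simp)
    have h2 := h1 G.1 (Finset.mem_filter.1 G.2).1
    simpa using h2
  have hle : Submodule.span ℝ (Set.range (fun G : T => mk (xR (S.R G.1)))) ≤
      Submodule.span ℝ (Set.range (fun m : Sym U k => ((m : Multiset U).map f).prod)) := by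
    rw [Submodule.span_le]
    rintro _ ⟨G, rfl⟩
    have := prod_mem_span f x hx (S.R G.1) k (Finset.mem_filter.1 G.2).2
    simpa [xR, map_prod] using this
  have h1 := finrank_span_eq_card hli
  have : FiniteDimensional ℝ (Submodule.span ℝ
      (Set.range (fun m : Sym U k => ((m : Multiset U).map f).prod))) :=
    FiniteDimensional.span_of_finite ℝ (Set.finite_range _)
  have h2 := Submodule.finrank_mono hle
  have h3 := finrank_range_le_card (R := ℝ) (fun m : Sym U k => ((m : Multiset U).map f).prod)
  unfold Set.finrank at h3
  have h4 : Fintype.card T = T.card := Fintype.card_coe T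
  have h5 : Fintype.card (Sym U k) = (Fintype.card U + k - 1).choose k := Sym.card_sym_eq_choose k
  have h6 : Fintype.card U = Fintype.card V - d := by
    rw [Fintype.card_subtype_compl, Fintype.card_coe, S.card G0 hG0]
  have h7 : (Fintype.card U + k - 1).choose k ≤ (Fintype.card V - d - 1 + k).choose k := by
    apply Nat.choose_le_choose
    omega
  change T.card ≤ _
  omega

end Alg


set_option linter.unusedSectionVars false
section Geom

variable {V : Type} [Fintype V] [DecidableEq V] {d : ℕ}

def Pol (y : V → Fin d → ℝ) (a : Fin d → ℝ) : Prop := ∀ v, a ⬝ᵥ y v ≤ 1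

open Classical in
def Tt (y : V → Fin d → ℝ) (a : Fin d → ℝ) : Finset V := univ.filter (fun v => a ⬝ᵥ y v = 1)

def Sp (y : V → Fin d → ℝ) (G : Finset V) : Prop :=
  ∀ u : Fin d → ℝ, (∀ v ∈ G, u ⬝ᵥ y v = 0) → u = 0

lemma mem_Tt (y : V → Fin d → ℝ) (a : Fin d → ℝ) (v : V) : v ∈ Tt y a ↔ a ⬝ᵥ y v = 1 := by
  simp [Tt]

lemma Sp_iff (y : V → Fin d → ℝ) (G : Finset V) :
    Sp y G ↔ Submodule.span ℝ (y '' (G : Set V)) = ⊤ := by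
  constructor
  · intro h
    by_contra hne
    obtain ⟨f, hf, hle⟩ := Submodule.exists_le_ker_of_lt_top _ (lt_top_iff_ne_top.2 hne)
    obtain ⟨u, rfl⟩ := (dotProductEquiv ℝ (Fin d)).surjective f
    apply hf
    rw [h u, map_zero]
    intro v hv
    have : y v ∈ LinearMap.ker (dotProductEquiv ℝ (Fin d) u) :=
      hle (Submodule.subset_span ⟨v, hv, rfl⟩)
    simpa using this
  · intro h u hu
    have : Submodule.span ℝ (y '' (G : Set V)) ≤ LinearMap.ker (dotProductEquiv ℝ (Fin d) u) := by
      rw [Submodule.span_le]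
      rintro _ ⟨v, hv, rfl⟩
      simpa using hu v hv
    rw [h, top_le_iff, LinearMap.ker_eq_top] at this
    exact (LinearEquiv.map_eq_zero_iff _).1 this

lemma exists_dual (y : V → Fin d → ℝ) (G : Finset V) (hG : G.card = d) (hs : Sp y G) :
    ∃ a : V → Fin d → ℝ, (∀ v ∈ G, ∀ w ∈ G, a v ⬝ᵥ y w = if v = w then 1 else 0) ∧
      ∀ c : Fin d → ℝ, ∑ v ∈ G, (a v ⬝ᵥ c) • y v = c := by
  rw [Sp_iff] at hs
  have hr : Set.range (fun v : G => y v.1) = y '' (G : Set V) := by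
    ext x; simp
  let b := basisOfTopLeSpanOfCardEqFinrank (R := ℝ) (fun v : G => y v.1)
    (by rw [hr, hs]) (by simp [hG])
  have hb : ∀ v : G, b v = y v.1 := by intro v; simp [b]
  let a : V → Fin d → ℝ := fun v =>
    if h : v ∈ G then (dotProductEquiv ℝ (Fin d)).symm (b.coord ⟨v, h⟩) else 0
  have ha : ∀ v (h : v ∈ G) x, a v ⬝ᵥ x = b.repr x ⟨v, h⟩ := by
    intro v h x
    have : dotProductEquiv ℝ (Fin d) (a v) = b.coord ⟨v, h⟩ := by
      simp only [a, dif_pos h, LinearEquiv.apply_symm_apply]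
    have h2 := LinearMap.congr_fun this x
    simpa using h2
  refine ⟨a, ?_, ?_⟩
  · intro v hv w hw
    rw [ha v hv, ← hb ⟨w, hw⟩, b.repr_self, Finsupp.single_apply]
    simp [eq_comm]
  · intro c
    conv_rhs => rw [← b.sum_repr c]
    rw [← Finset.sum_attach]
    apply Finset.sum_congr rfl
    intro v _
    rw [ha v.1 v.2, hb]

lemma extend (y : V → Fin d → ℝ) (H0 : ∀ u : Fin d → ℝ, u ≠ 0 → ∃ v, 0 < u ⬝ᵥ y v)
    (a u : Fin d → ℝ) (ha : Pol y a) (hu : u ≠ 0) (hT : ∀ v ∈ Tt y a, u ⬝ᵥ y v ≤ 0) :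
    ∃ t : ℝ, 0 < t ∧ Pol y (a + t • u) ∧ ∃ w, 0 < u ⬝ᵥ y w ∧ w ∈ Tt y (a + t • u) := by
  classical
  obtain ⟨v0, hv0⟩ := H0 u hu
  obtain ⟨w, hw, hmin⟩ := Finset.exists_min_image (univ.filter (fun v => 0 < u ⬝ᵥ y v))
    (fun v => (1 - a ⬝ᵥ y v) / (u ⬝ᵥ y v)) ⟨v0, by simp [hv0]⟩
  simp only [Finset.mem_filter, Finset.mem_univ, true_and] at hw hmin
  have hpos : 0 < 1 - a ⬝ᵥ y w := by
    have h1 := ha w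
    have h2 : a ⬝ᵥ y w ≠ 1 := fun h => absurd (hT w ((mem_Tt _ _ _).2 h)) (not_le.2 hw)
    have := lt_of_le_of_ne h1 h2
    linarith
  have ht : 0 < (1 - a ⬝ᵥ y w) / (u ⬝ᵥ y w) := div_pos hpos hw
  refine ⟨(1 - a ⬝ᵥ y w) / (u ⬝ᵥ y w), ht, ?_, w, hw, ?_⟩
  · intro v
    rw [add_dotProduct, smul_dotProduct, smul_eq_mul]
    by_cases hv : 0 < u ⬝ᵥ y v
    · have := hmin v hv
      rw [le_div_iff₀ hv] at this
      linarith
    · have := mul_nonneg ht.le (neg_nonneg.2 (not_lt.1 hv))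
      have := ha v
      linarith
  · rw [mem_Tt, add_dotProduct, smul_dotProduct, smul_eq_mul, div_mul_cancel₀ _ hw.ne']
    ring

lemma descent (y : V → Fin d → ℝ) (H0 : ∀ u : Fin d → ℝ, u ≠ 0 → ∃ v, 0 < u ⬝ᵥ y v)
    (c : Fin d → ℝ) (n : ℕ) : ∀ a : Fin d → ℝ, Pol y a → Fintype.card V - (Tt y a).card = n →
    ∃ a', Pol y a' ∧ Tt y a ⊆ Tt y a' ∧ Sp y (Tt y a') ∧ a' ⬝ᵥ c ≤ a ⬝ᵥ c := by
  induction n using Nat.strong_induction_on with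
  | _ n ih =>
    intro a ha hn
    by_cases hs : Sp y (Tt y a)
    · exact ⟨a, ha, subset_rfl, hs, le_rfl⟩
    · unfold Sp at hs
      push Not at hs
      obtain ⟨u0, hu0, hne0⟩ := hs
      obtain ⟨u, hu, hne, huc⟩ : ∃ u : Fin d → ℝ, (∀ v ∈ Tt y a, u ⬝ᵥ y v = 0) ∧ u ≠ 0 ∧
          u ⬝ᵥ c ≤ 0 := by
        rcases le_total (u0 ⬝ᵥ c) 0 with h | h
        · exact ⟨u0, hu0, hne0, h⟩
        · refine ⟨-u0, ?_, neg_ne_zero.2 hne0, ?_⟩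
          · intro v hv; rw [neg_dotProduct, hu0 v hv, neg_zero]
          · rw [neg_dotProduct]; linarith
      obtain ⟨t, ht, hp, w, hw, hwT⟩ := extend y H0 a u ha hne (fun v hv => (hu v hv).le)
      have hsub : Tt y a ⊆ Tt y (a + t • u) := by
        intro v hv
        rw [mem_Tt, add_dotProduct, smul_dotProduct, hu v hv, smul_zero, add_zero]
        exact (mem_Tt _ _ _).1 hv
      have hwn : w ∉ Tt y a := fun h => by rw [hu w h] at hw; exact lt_irrefl _ hw
      have hlt : (Tt y a).card < (Tt y (a + t • u)).card :=
        Finset.card_lt_card ⟨hsub, fun h => hwn (h hwT)⟩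
      have hle : (Tt y (a + t • u)).card ≤ Fintype.card V := Finset.card_le_univ _
      obtain ⟨a', h1, h2, h3, h4⟩ := ih _ (by omega) (a + t • u) hp rfl
      refine ⟨a', h1, hsub.trans h2, h3, h4.trans ?_⟩
      rw [add_dotProduct, smul_dotProduct, smul_eq_mul]
      have := mul_nonneg ht.le (neg_nonneg.2 huc)
      linarith

structure Geo (V : Type) [Fintype V] [DecidableEq V] (d : ℕ) where
  y : V → Fin d → ℝ
  H0 : ∀ u : Fin d → ℝ, u ≠ 0 → ∃ v, 0 < u ⬝ᵥ y v
  aF : Fin d → ℝ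
  polF : Pol y aF
  spF : Sp y (Tt y aF)
  hcard : ∀ a, Pol y a → Sp y (Tt y a) → a ≠ aF → (Tt y a).card = d
  hd : 0 < d

variable (Γ : Geo V d)

open Classical in
def Geo.fac : Finset (Finset V) :=
  univ.filter (fun G => ∃ a, Pol Γ.y a ∧ Sp Γ.y (Tt Γ.y a) ∧ a ≠ Γ.aF ∧ Tt Γ.y a = G)

lemma Geo.mem_fac (G : Finset V) : G ∈ Γ.fac ↔
    ∃ a, Pol Γ.y a ∧ Sp Γ.y (Tt Γ.y a) ∧ a ≠ Γ.aF ∧ Tt Γ.y a = G := by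
  simp [Geo.fac]

lemma Geo.exA : ∃ A : Finset V → V → Fin d → ℝ, ∀ G ∈ Γ.fac,
    (∀ v ∈ G, ∀ w ∈ G, A G v ⬝ᵥ Γ.y w = if v = w then 1 else 0) ∧
      ∀ c : Fin d → ℝ, ∑ v ∈ G, (A G v ⬝ᵥ c) • Γ.y v = c := by
  have : ∀ G, ∃ a : V → Fin d → ℝ, G ∈ Γ.fac →
    (∀ v ∈ G, ∀ w ∈ G, a v ⬝ᵥ Γ.y w = if v = w then 1 else 0) ∧
      ∀ c : Fin d → ℝ, ∑ v ∈ G, (a v ⬝ᵥ c) • Γ.y v = c := by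
    intro G
    by_cases hG : G ∈ Γ.fac
    · obtain ⟨a, h1, h2, h3, h4⟩ := (Γ.mem_fac G).1 hG
      subst h4
      obtain ⟨b, hb⟩ := exists_dual Γ.y _ (Γ.hcard a h1 h2 h3) h2
      exact ⟨b, fun _ => hb⟩
    · exact ⟨fun _ _ => 0, fun h => absurd h hG⟩
  choose A hA using this
  exact ⟨A, hA⟩

def Geo.A : Finset V → V → Fin d → ℝ := Classical.choose Γ.exA
lemma Geo.A1 (G) (hG : G ∈ Γ.fac) (v) (hv : v ∈ G) (w) (hw : w ∈ G) :
    Γ.A G v ⬝ᵥ Γ.y w = if v = w then 1 else 0 := (Classical.choose_spec Γ.exA G hG).1 v hv w hw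
lemma Geo.A2 (G) (hG : G ∈ Γ.fac) (c : Fin d → ℝ) :
    ∑ v ∈ G, (Γ.A G v ⬝ᵥ c) • Γ.y v = c := (Classical.choose_spec Γ.exA G hG).2 c

lemma Geo.exc : ∃ c : Fin d → ℝ, (∀ a, Pol Γ.y a → a ≠ Γ.aF → a ⬝ᵥ c < Γ.aF ⬝ᵥ c) ∧
    ∀ G ∈ Γ.fac, ∀ v ∈ G, Γ.A G v ⬝ᵥ c ≠ 0 := by
  classical
  let ι := {p : Finset V × V // p.1 ∈ Γ.fac ∧ p.2 ∈ p.1}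
  obtain ⟨f, hf⟩ := Module.exists_dual_forall_apply_ne_zero (K := ℝ)
    (fun p : ι => Γ.A p.1.1 p.1.2) (by
      intro p h
      have := Γ.A1 p.1.1 p.2.1 p.1.2 p.2.2 p.1.2 p.2.2
      rw [h] at this
      simp at this)
  obtain ⟨δ, rfl⟩ := (dotProductEquiv ℝ (Fin d)).surjective f
  have hspan := (Sp_iff _ _).1 Γ.spF
  have hδ : δ ∈ Submodule.span ℝ (Γ.y '' (Tt Γ.y Γ.aF : Set V)) := by rw [hspan]; trivial
  rw [Submodule.mem_span_image_finset_iff_exists_fun] at hδ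
  obtain ⟨μ, hμ⟩ := hδ
  let T := Tt Γ.y Γ.aF
  let c0 : Fin d → ℝ := ∑ v : T, Γ.y v.1
  have e1 : ∀ᶠ t in nhdsWithin (0:ℝ) (Set.Ioi 0), ∀ v : T, 0 < 1 + t * μ v := by
    rw [Filter.eventually_all]
    intro v
    apply Filter.Eventually.filter_mono nhdsWithin_le_nhds
    have : ContinuousAt (fun t : ℝ => 1 + t * μ v) 0 := by fun_prop
    exact this.eventually_const_lt (by simp)
  have e2 : ∀ᶠ t in nhdsWithin (0:ℝ) (Set.Ioi 0), ∀ p : ι,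
      Γ.A p.1.1 p.1.2 ⬝ᵥ (c0 + t • δ) ≠ 0 := by
    rw [Filter.eventually_all]
    intro p
    by_cases h : Γ.A p.1.1 p.1.2 ⬝ᵥ c0 = 0
    · filter_upwards [self_mem_nhdsWithin] with t ht
      rw [dotProduct_add, h, zero_add, dotProduct_smul, smul_eq_mul]
      have h2 := hf p
      simp only [dotProductEquiv_apply_apply] at h2
      rw [dotProduct_comm] at h2
      exact mul_ne_zero (ne_of_gt ht) h2
    · apply Filter.Eventually.filter_mono nhdsWithin_le_nhds
      have hcont : ContinuousAt (fun t : ℝ => Γ.A p.1.1 p.1.2 ⬝ᵥ (c0 + t • δ)) 0 := by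
        simp only [dotProduct_add, dotProduct_smul, smul_eq_mul]
        fun_prop
      exact hcont.eventually_ne (by simpa using h)
  obtain ⟨t, h1, h2⟩ := (e1.and e2).exists
  refine ⟨c0 + t • δ, ?_, ?_⟩
  · intro a ha hne
    have hc : c0 + t • δ = ∑ v : T, (1 + t * μ v) • Γ.y v.1 := by
      simp only [c0]
      rw [← hμ, Finset.smul_sum, ← Finset.sum_add_distrib]
      apply Finset.sum_congr rfl
      intro v _
      rw [add_smul, one_smul, mul_smul]
    rw [hc, dotProduct_sum, dotProduct_sum]
    have hF : ∀ v : T, Γ.aF ⬝ᵥ Γ.y v.1 = 1 := fun v => (mem_Tt _ _ _).1 v.2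
    apply Finset.sum_lt_sum
    · intro v _
      rw [dotProduct_smul, dotProduct_smul, hF, smul_eq_mul, smul_eq_mul]
      exact mul_le_mul_of_nonneg_left (ha v) (h1 v).le
    · by_contra hcon
      push Not at hcon
      apply hne
      have : a - Γ.aF = 0 := by
        apply Γ.spF
        intro v hv
        have h3 := hcon ⟨v, hv⟩ (Finset.mem_univ _)
        rw [dotProduct_smul, dotProduct_smul, hF, smul_eq_mul, smul_eq_mul] at h3
        have h4 := le_of_mul_le_mul_left h3 (h1 ⟨v, hv⟩)
        have h5 := ha v
        rw [sub_dotProduct, (mem_Tt _ _ _).1 hv]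
        simp only at h4
        linarith
      exact sub_eq_zero.1 this
  · intro G hG v hv
    exact h2 ⟨(G, v), hG, hv⟩

def Geo.c : Fin d → ℝ := Classical.choose Γ.exc
lemma Geo.cF : ∀ a, Pol Γ.y a → a ≠ Γ.aF → a ⬝ᵥ Γ.c < Γ.aF ⬝ᵥ Γ.c := (Classical.choose_spec Γ.exc).1
lemma Geo.cne : ∀ G ∈ Γ.fac, ∀ v ∈ G, Γ.A G v ⬝ᵥ Γ.c ≠ 0 := (Classical.choose_spec Γ.exc).2

lemma Geo.exfac (a : Fin d → ℝ) (ha : Pol Γ.y a) (hne : a ≠ Γ.aF) :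
    ∃ a', Tt Γ.y a ⊆ Tt Γ.y a' ∧ Tt Γ.y a' ∈ Γ.fac ∧ a' ⬝ᵥ Γ.c ≤ a ⬝ᵥ Γ.c ∧ Pol Γ.y a' := by
  obtain ⟨a', h1, h2, h3, h4⟩ := descent Γ.y Γ.H0 Γ.c _ a ha rfl
  refine ⟨a', h2, (Γ.mem_fac _).2 ⟨a', h1, h3, ?_, rfl⟩, h4, h1⟩
  rintro rfl
  exact absurd (Γ.cF a ha hne) (not_lt.2 h4)

lemma Geo.dot_eq (G) (hG : G ∈ Γ.fac) (a x : Fin d → ℝ) :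
    a ⬝ᵥ x = ∑ v ∈ G, (Γ.A G v ⬝ᵥ x) * (a ⬝ᵥ Γ.y v) := by
  conv_lhs => rw [← Γ.A2 G hG x, dotProduct_sum]
  simp [dotProduct_smul]

def Geo.R (G : Finset V) : Finset V := by
  classical exact G.filter (fun v => 0 < Γ.A G v ⬝ᵥ Γ.c)
def Geo.val (G : Finset V) : ℝ := ∑ v ∈ G, Γ.A G v ⬝ᵥ Γ.c

lemma Geo.val_eq (a : Fin d → ℝ) (hG : Tt Γ.y a ∈ Γ.fac) : a ⬝ᵥ Γ.c = Γ.val (Tt Γ.y a) := by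
  rw [Γ.dot_eq _ hG]
  unfold Geo.val
  apply Finset.sum_congr rfl
  intro v hv
  rw [(mem_Tt _ _ _).1 hv, mul_one]

def Geo.shell : Shell V d where
  y := Γ.y
  𝒢 := Γ.fac
  R := Γ.R
  val := Γ.val
  a := Γ.A
  ne := by
    have h0 : (0 : Fin d → ℝ) ≠ Γ.aF := by
      intro h
      have hs := Γ.spF
      have : Tt Γ.y Γ.aF = ∅ := by
        ext v
        rw [mem_Tt, ← h]; simp
      have h1 := hs (fun _ => 1) (by rw [this]; simp)
      have := congr_fun h1 ⟨0, Γ.hd⟩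
      simp at this
    obtain ⟨a, -, h, -⟩ := Γ.exfac 0 (by intro v; simp) h0
    exact ⟨_, h⟩
  card := by
    intro G hG
    obtain ⟨a, h1, h2, h3, rfl⟩ := (Γ.mem_fac G).1 hG
    exact Γ.hcard a h1 h2 h3
  h1 := Γ.A1
  h2 := Γ.A2
  RG := by
    intro G _
    exact Finset.filter_subset _ _
  lt := by
    intro G hG G' hG' hR hne
    obtain ⟨a, h1, h2, h3, rfl⟩ := (Γ.mem_fac G').1 hG'
    have hc1 := Γ.hcard a h1 h2 h3
    have hc2 : G.card = d := by
      obtain ⟨a, h1, h2, h3, rfl⟩ := (Γ.mem_fac G).1 hG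
      exact Γ.hcard a h1 h2 h3
    rw [← Γ.val_eq a hG', Γ.dot_eq G hG a Γ.c]
    unfold Geo.val
    have hneg : ∀ v ∈ G, v ∉ Tt Γ.y a → Γ.A G v ⬝ᵥ Γ.c < 0 := by
      intro v hv hvn
      have : ¬ 0 < Γ.A G v ⬝ᵥ Γ.c := fun h => hvn (hR (by simp [Geo.R, hv, h]))
      exact lt_of_le_of_ne (not_lt.1 this) (Γ.cne G hG v hv)
    apply Finset.sum_lt_sum
    · intro v hv
      by_cases hvn : v ∈ Tt Γ.y a
      · rw [(mem_Tt _ _ _).1 hvn, mul_one]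
      · nlinarith [hneg v hv hvn, h1 v]
    · have : ¬ G ⊆ Tt Γ.y a := fun h => hne (Finset.eq_of_subset_of_card_le h (by omega))
      obtain ⟨v, hv, hvn⟩ := Finset.not_subset.1 this
      refine ⟨v, hv, ?_⟩
      have hlt : a ⬝ᵥ Γ.y v < 1 := lt_of_le_of_ne (h1 v) (fun h => hvn ((mem_Tt _ _ _).2 h))
      nlinarith [hneg v hv hvn]
  ex := by
    classical
    intro G0 hG0 σ hσ0
    obtain ⟨G, hG, hmin⟩ := Finset.exists_min_image (Γ.fac.filter (fun G => σ ⊆ G)) Γ.val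
      ⟨G0, by simp [hG0, hσ0]⟩
    simp only [Finset.mem_filter] at hG hmin
    obtain ⟨hG, hσ⟩ := hG
    refine ⟨G, hG, ?_, hσ⟩
    intro v hv
    by_contra hvσ
    simp only [Geo.R, Finset.mem_filter] at hv
    obtain ⟨hv, hpos⟩ := hv
    obtain ⟨a, h1, h2, h3, rfl⟩ := (Γ.mem_fac G).1 hG
    have hu : ∀ w ∈ Tt Γ.y a, (-(Γ.A (Tt Γ.y a) v)) ⬝ᵥ Γ.y w = if v = w then -1 else 0 := by
      intro w hw
      rw [neg_dotProduct, Γ.A1 _ hG v hv w hw]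
      split_ifs <;> simp
    obtain ⟨t, ht, hp, -⟩ := extend Γ.y Γ.H0 a (-(Γ.A (Tt Γ.y a) v)) h1
      (by intro h; rw [neg_eq_zero] at h; rw [h] at hpos; simp at hpos)
      (by intro w hw; rw [hu w hw]; split_ifs <;> norm_num)
    have hlt : (a + t • (-(Γ.A (Tt Γ.y a) v))) ⬝ᵥ Γ.c < a ⬝ᵥ Γ.c := by
      rw [add_dotProduct, smul_dotProduct, neg_dotProduct, smul_eq_mul]
      nlinarith
    have hne : a + t • (-(Γ.A (Tt Γ.y a) v)) ≠ Γ.aF := by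
      intro h
      rw [h] at hlt
      exact absurd (Γ.cF a h1 h3) (not_lt.2 hlt.le)
    obtain ⟨a', g1, g2, g3, g4⟩ := Γ.exfac _ hp hne
    have hσ' : σ ⊆ Tt Γ.y a' := by
      intro w hw
      apply g1
      rw [mem_Tt, add_dotProduct, smul_dotProduct, hu w (hσ hw), if_neg, smul_zero, add_zero]
      · exact (mem_Tt _ _ _).1 (hσ hw)
      · rintro rfl; exact hvσ hw
    have := hmin _ ⟨g2, hσ'⟩
    rw [← Γ.val_eq a hG, ← Γ.val_eq a' g2] at this
    linarith

lemma Geo.subface (G) (hG : G ∈ Γ.fac) (σ : Finset V) (hσ : σ ⊆ G) :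
    ∃ a, Pol Γ.y a ∧ Tt Γ.y a = σ := by
  classical
  obtain ⟨a, h1, h2, h3, rfl⟩ := (Γ.mem_fac G).1 hG
  set G := Tt Γ.y a
  let s : Fin d → ℝ := ∑ v ∈ G \ σ, Γ.A G v
  have hs : ∀ w ∈ G, s ⬝ᵥ Γ.y w = if w ∈ σ then 0 else 1 := by
    intro w hw
    simp only [s]
    rw [sum_dotProduct]
    have : ∀ v ∈ G \ σ, Γ.A G v ⬝ᵥ Γ.y w = if v = w then 1 else 0 := by
      intro v hv
      exact Γ.A1 G hG v (Finset.mem_sdiff.1 hv).1 w hw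
    rw [Finset.sum_congr rfl this]
    by_cases hwσ : w ∈ σ <;> simp [hwσ, hw]
  have e : ∀ᶠ t in nhdsWithin (0:ℝ) (Set.Ioi 0), ∀ v : {v // v ∉ G}, (a - t • s) ⬝ᵥ Γ.y v.1 < 1 := by
    rw [Filter.eventually_all]
    intro v
    apply Filter.Eventually.filter_mono nhdsWithin_le_nhds
    have hcont : ContinuousAt (fun t : ℝ => (a - t • s) ⬝ᵥ Γ.y v.1) 0 := by
      simp only [sub_dotProduct, smul_dotProduct, smul_eq_mul]
      fun_prop
    apply hcont.eventually_lt_const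
    simp only [zero_smul, sub_zero]
    exact lt_of_le_of_ne (h1 v) (fun h => v.2 ((mem_Tt _ _ _).2 h))
  obtain ⟨t, h4, h5⟩ := (e.and self_mem_nhdsWithin).exists
  have h5' : 0 < t := h5
  have hval : ∀ w ∈ G, (a - t • s) ⬝ᵥ Γ.y w = if w ∈ σ then 1 else 1 - t := by
    intro w hw
    rw [sub_dotProduct, smul_dotProduct, hs w hw, (mem_Tt _ _ _).1 hw]
    split_ifs <;> simp
  refine ⟨a - t • s, ?_, ?_⟩
  · intro v
    by_cases hv : v ∈ G
    · rw [hval v hv]; split_ifs <;> linarith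
    · exact (h4 ⟨v, hv⟩).le
  · ext v
    rw [mem_Tt]
    by_cases hv : v ∈ G
    · rw [hval v hv]
      split_ifs with h
      · simp [h]
      · simp only [h, iff_false]; linarith
    · have := (h4 ⟨v, hv⟩).ne
      simp only at this
      exact iff_of_false this (fun h => hv (hσ h))

/-- linear independence of faces -/
lemma Geo.li (G) (hG : G ∈ Γ.fac) (σ : Finset V) (hσ : σ ⊆ G) :
    LinearIndependent ℝ (fun v : σ => Γ.y v.1) := by
  rw [Fintype.linearIndependent_iff]
  intro g hg v
  have := congrArg (fun x => Γ.A G v.1 ⬝ᵥ x) hg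
  simp only [dotProduct_sum, dotProduct_smul, dotProduct_zero, smul_eq_mul] at this
  rw [Finset.sum_eq_single v] at this
  · rw [Γ.A1 G hG v.1 (hσ v.2) v.1 (hσ v.2)] at this
    simpa using this
  · intro w _ hw
    rw [Γ.A1 G hG v.1 (hσ v.2) w.1 (hσ w.2), if_neg, mul_zero]
    intro h; exact hw (Subtype.ext h.symm)
  · simp

end Geom


set_option linter.unusedSectionVars false
section Cnt

variable {V : Type} [Fintype V] [DecidableEq V] {d : ℕ}

lemma binom_inv (d r k : ℕ) (hr : r ≤ d) :
    ∑ i ∈ Finset.range (k + 1), (-1 : ℤ) ^ (k - i) * ((d - i).choose (k - i) : ℤ) *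
      ((if r ≤ i then (d - r).choose (i - r) else 0 : ℕ) : ℤ) = if r = k then 1 else 0 := by
  by_cases hrk : r ≤ k
  · obtain ⟨K, rfl⟩ := Nat.exists_eq_add_of_le hrk
    obtain ⟨N, rfl⟩ := Nat.exists_eq_add_of_le hr
    rw [add_assoc, Finset.sum_range_add, Finset.sum_eq_zero, zero_add]
    · have : ∀ m ∈ Finset.range (K + 1), (-1 : ℤ) ^ (r + K - (r + m)) *
          ((r + N - (r + m)).choose (r + K - (r + m)) : ℤ) *
          ((if r ≤ r + m then (r + N - r).choose (r + m - r) else 0 : ℕ) : ℤ)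
          = ((-1) ^ K * (N.choose K : ℤ)) * ((-1) ^ m * (K.choose m : ℤ)) := by
        intro m hm
        have hm' : m ≤ K := by simpa [Nat.lt_succ_iff] using hm
        have e := Nat.choose_mul (n := N) hm'
        rw [if_pos (Nat.le_add_right _ _), Nat.add_sub_add_left, Nat.add_sub_add_left,
          Nat.add_sub_cancel_left, Nat.add_sub_cancel_left]
        have e' : (N.choose K : ℤ) * (K.choose m : ℤ) = (N.choose m : ℤ) * ((N - m).choose (K - m) : ℤ) := by
          exact_mod_cast e
        have e2 : (-1 : ℤ) ^ K * (-1) ^ m = (-1) ^ (K - m) := by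
          obtain ⟨j, rfl⟩ := Nat.exists_eq_add_of_le hm'
          rw [Nat.add_sub_cancel_left, pow_add]
          have : (-1 : ℤ) ^ m * (-1) ^ m = 1 := by rw [← mul_pow]; simp
          calc (-1 : ℤ) ^ m * (-1) ^ j * (-1) ^ m = (-1) ^ j * ((-1 : ℤ) ^ m * (-1) ^ m) := by ring
            _ = _ := by rw [this, mul_one]
        rw [← e2]
        linear_combination (-(-1 : ℤ) ^ K * (-1) ^ m) * e'
      rw [Finset.sum_congr rfl this, ← Finset.mul_sum, Int.alternating_sum_range_choose]
      by_cases hK : K = 0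
      · subst hK; simp
      · have h2 : ¬ r = r + K := by omega
        rw [if_neg hK, if_neg h2, mul_zero]
    · intro i hi
      have : ¬ r ≤ i := by have := Finset.mem_range.1 hi; omega
      simp [this]
  · rw [if_neg (by omega)]
    apply Finset.sum_eq_zero
    intro i hi
    have : ¬ r ≤ i := by have := Finset.mem_range.1 hi; omega
    simp [this]

lemma card_interval (R G : Finset V) (hRG : R ⊆ G) (i : ℕ) :
    (univ.filter (fun σ : Finset V => σ.card = i ∧ R ⊆ σ ∧ σ ⊆ G)).card
      = if R.card ≤ i then (G.card - R.card).choose (i - R.card) else 0 := by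
  split_ifs with h
  · rw [← Finset.card_sdiff_of_subset hRG, ← Finset.card_powersetCard]
    apply Finset.card_bij' (fun σ _ => σ \ R) (fun τ _ => τ ∪ R)
    · intro σ hσ
      simp only [Finset.mem_filter, Finset.mem_univ, true_and] at hσ
      rw [Finset.mem_powersetCard, Finset.card_sdiff_of_subset hσ.2.1, hσ.1]
      exact ⟨Finset.sdiff_subset_sdiff hσ.2.2 subset_rfl, rfl⟩
    · intro τ hτ
      rw [Finset.mem_powersetCard] at hτ
      have hdis : Disjoint τ R := Finset.disjoint_of_subset_left hτ.1 Finset.sdiff_disjoint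
      simp only [Finset.mem_filter, Finset.mem_univ, true_and]
      refine ⟨by rw [Finset.card_union_of_disjoint hdis, hτ.2]; omega, Finset.subset_union_right,
        Finset.union_subset (hτ.1.trans Finset.sdiff_subset) hRG⟩
    · intro σ hσ
      simp only [Finset.mem_filter, Finset.mem_univ, true_and] at hσ
      exact Finset.sdiff_union_of_subset hσ.2.1
    · intro τ hτ
      rw [Finset.mem_powersetCard] at hτ
      have hdis : Disjoint τ R := Finset.disjoint_of_subset_left hτ.1 Finset.sdiff_disjoint
      exact Finset.union_sdiff_cancel_right hdis
  · rw [Finset.card_eq_zero, Finset.filter_eq_empty_iff]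
    rintro σ - ⟨h1, h2, -⟩
    have := Finset.card_le_card h2
    omega

variable (S : Shell V d)

open Classical in
def Shell.f (i : ℕ) : ℕ :=
  (univ.filter (fun σ : Finset V => σ.card = i ∧ ∃ G ∈ S.𝒢, σ ⊆ G)).card

lemma Shell.f_eq (i : ℕ) : S.f i =
    ∑ G ∈ S.𝒢, if (S.R G).card ≤ i then (d - (S.R G).card).choose (i - (S.R G).card) else 0 := by
  classical
  have : (univ.filter (fun σ : Finset V => σ.card = i ∧ ∃ G ∈ S.𝒢, σ ⊆ G))
    = S.𝒢.biUnion (fun G => univ.filter (fun σ : Finset V => σ.card = i ∧ S.R G ⊆ σ ∧ σ ⊆ G)) := by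
    ext σ
    simp only [Finset.mem_filter, Finset.mem_univ, true_and, Finset.mem_biUnion]
    constructor
    · rintro ⟨h, G, hG, hs⟩
      obtain ⟨G', h1, h2, h3⟩ := S.ex G hG σ hs
      exact ⟨G', h1, h, h2, h3⟩
    · rintro ⟨G, hG, h, h2, h3⟩
      exact ⟨h, G, hG, h3⟩
  unfold Shell.f
  rw [this, Finset.card_biUnion]
  · apply Finset.sum_congr rfl
    intro G hG
    rw [card_interval _ _ (S.RG G hG), S.card G hG]
  · intro G hG G' hG' hne
    change Disjoint _ _
    rw [Finset.disjoint_left]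
    intro σ h1 h2
    simp only [Finset.mem_filter, Finset.mem_univ, true_and] at h1 h2
    have := S.lt G hG G' hG' (h1.2.1.trans h2.2.2) hne
    have := S.lt G' hG' G hG (h2.2.1.trans h1.2.2) hne.symm
    linarith

lemma Shell.f_zero : S.f 0 = 1 := by
  classical
  unfold Shell.f
  rw [Finset.card_eq_one]
  refine ⟨∅, ?_⟩
  ext σ
  simp only [Finset.mem_filter, Finset.mem_univ, true_and, Finset.card_eq_zero, Finset.mem_singleton]
  constructor
  · exact fun h => h.1
  · rintro rfl
    obtain ⟨G, hG⟩ := S.ne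
    exact ⟨rfl, G, hG, Finset.empty_subset _⟩

theorem Shell.h_le (k : ℕ) :
    ∑ i ∈ Finset.range (k + 1), (-1 : ℤ) ^ (k - i) * ((d - i).choose (k - i) : ℤ) * (S.f i : ℤ)
      ≤ ((Fintype.card V - d - 1 + k).choose k : ℤ) := by
  have h := S.bound k
  have : ∑ i ∈ Finset.range (k + 1), (-1 : ℤ) ^ (k - i) * ((d - i).choose (k - i) : ℤ) * (S.f i : ℤ)
      = (S.𝒢.filter (fun G => (S.R G).card = k)).card := by
    simp_rw [S.f_eq, Nat.cast_sum, Finset.mul_sum]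
    rw [Finset.sum_comm, Finset.card_filter, Nat.cast_sum]
    apply Finset.sum_congr rfl
    intro G hG
    rw [binom_inv d (S.R G).card k (le_of_le_of_eq (Finset.card_le_card (S.RG G hG)) (S.card G hG))]
    split_ifs <;> simp
  rw [this]
  exact_mod_cast h

end Cnt


section PolyD
variable {d : ℕ}

lemma verts_finite {P : Set (Fin d → ℝ)} (hP : IsPolytope P) : (verts P).Finite := by
  obtain ⟨W, rfl⟩ := hP
  exact W.finite_toSet.subset extremePoints_convexHull_subset

lemma poly_compact {P : Set (Fin d → ℝ)} (hP : IsPolytope P) : IsCompact P := by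
  obtain ⟨W, rfl⟩ := hP
  exact W.finite_toSet.isCompact_convexHull ℝ

lemma poly_convex {P : Set (Fin d → ℝ)} (hP : IsPolytope P) : Convex ℝ P := by
  obtain ⟨W, rfl⟩ := hP
  exact convex_convexHull ℝ _

lemma hull_verts {H : Set (Fin d → ℝ)} (hc : IsCompact H) (hv : Convex ℝ H)
    (hf : (verts H).Finite) : convexHull ℝ (verts H) = H := by
  have h := closure_convexHull_extremePoints hc hv
  have h2 : IsClosed (convexHull ℝ (verts H)) := hf.isClosed_convexHull ℝ
  rw [← h2.closure_eq]
  exact h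

def face (P : Set (Fin d → ℝ)) (o a : Fin d → ℝ) : Set (Fin d → ℝ) :=
  {x ∈ P | a ⬝ᵥ (x - o) = 1}

lemma face_extreme {P : Set (Fin d → ℝ)} {o a : Fin d → ℝ}
    (hp : ∀ x ∈ P, a ⬝ᵥ (x - o) ≤ 1) : IsExtreme ℝ P (face P o a) := by
  refine ⟨fun x hx => hx.1, ?_⟩
  rintro x1 h1 x2 h2 x hx ⟨s, t, hs, ht, hst, rfl⟩
  refine ⟨h1, ?_⟩
  have e := hx.2
  have : s • x1 + t • x2 - o = s • (x1 - o) + t • (x2 - o) := by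
    have : o = s • o + t • o := by rw [← add_smul, hst, one_smul]
    nth_rewrite 1 [this]
    module
  rw [this, dotProduct_add, dotProduct_smul, dotProduct_smul, smul_eq_mul, smul_eq_mul] at e
  have a1 := hp x1 h1
  have a2 := hp x2 h2
  by_contra hne
  have : a ⬝ᵥ (x1 - o) < 1 := lt_of_le_of_ne a1 hne
  nlinarith

lemma verts_face {P : Set (Fin d → ℝ)} {o a : Fin d → ℝ}
    (hp : ∀ x ∈ P, a ⬝ᵥ (x - o) ≤ 1) : verts (face P o a) = face P o a ∩ verts P :=
  (face_extreme hp).extremePoints_eq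

lemma cont_dot (o a : Fin d → ℝ) : Continuous (fun x : Fin d → ℝ => a ⬝ᵥ (x - o)) := by
  unfold dotProduct
  fun_prop

lemma face_hull {P : Set (Fin d → ℝ)} (hP : IsPolytope P) {o a : Fin d → ℝ}
    (hp : ∀ x ∈ P, a ⬝ᵥ (x - o) ≤ 1) : convexHull ℝ (verts (face P o a)) = face P o a := by
  apply hull_verts
  · exact (poly_compact hP).inter_right (isClosed_eq (cont_dot o a) continuous_const)
  · have : face P o a = P ∩ {x | a ⬝ᵥ (x - o) = 1} := rfl
    rw [this]
    refine (poly_convex hP).inter ?_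
    intro x hx z hz s t hs ht hst
    have : s • x + t • z - o = s • (x - o) + t • (z - o) := by
      have : o = s • o + t • o := by rw [← add_smul, hst, one_smul]
      nth_rewrite 1 [this]
      module
    simp only [Set.mem_setOf_eq] at *
    rw [this, dotProduct_add, dotProduct_smul, dotProduct_smul, hx, hz]
    simpa using hst
  · rw [verts_face hp]
    exact (verts_finite hP).subset Set.inter_subset_right

lemma polyDim_hull (S : Set (Fin d → ℝ)) :
    polyDim (convexHull ℝ S) = Module.finrank ℝ (vectorSpan ℝ S) := by
  unfold polyDim
  rw [affineSpan_convexHull, direction_affineSpan]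

lemma rank_one (S : Set (Fin d → ℝ)) (hS : S.Nonempty) (o a : Fin d → ℝ)
    (ha : ∀ w ∈ S, a ⬝ᵥ (w - o) = 1) :
    Module.finrank ℝ (Submodule.span ℝ ((fun w => w - o) '' S)) =
      Module.finrank ℝ (vectorSpan ℝ S) + 1 := by
  obtain ⟨p, hp⟩ := hS
  have hv := vectorSpan_eq_span_vsub_set_right ℝ hp
  have e1 : Submodule.span ℝ ((fun w => w - o) '' S) =
      vectorSpan ℝ S ⊔ Submodule.span ℝ {p - o} := by
    apply le_antisymm
    · rw [Submodule.span_le]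
      rintro _ ⟨w, hw, rfl⟩
      have : w - o = (w - p) + (p - o) := by abel
      simp only [this]
      exact Submodule.add_mem _ (Submodule.mem_sup_left (vsub_mem_vectorSpan ℝ hw hp))
        (Submodule.mem_sup_right (Submodule.mem_span_singleton_self _))
    · rw [hv]
      refine sup_le ?_ ?_
      · rw [Submodule.span_le]
        rintro _ ⟨w, hw, rfl⟩
        have : w -ᵥ p = (w - o) - (p - o) := by rw [vsub_eq_sub]; abel
        simp only [this]
        exact Submodule.sub_mem _ (Submodule.subset_span ⟨w, hw, rfl⟩)
          (Submodule.subset_span ⟨p, hp, rfl⟩)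
      · rw [Submodule.span_le, Set.singleton_subset_iff]
        exact Submodule.subset_span ⟨p, hp, rfl⟩
  have hz : ∀ u ∈ vectorSpan ℝ S, a ⬝ᵥ u = 0 := by
    intro u hu
    rw [hv] at hu
    induction hu using Submodule.span_induction with
    | mem x hx =>
      obtain ⟨w, hw, rfl⟩ := hx
      have : w -ᵥ p = (w - o) - (p - o) := by rw [vsub_eq_sub]; abel
      simp only [this]
      rw [dotProduct_sub, ha w hw, ha p hp, sub_self]
    | zero => simp
    | add x y _ _ hx hy => rw [dotProduct_add, hx, hy, add_zero]
    | smul c x _ hx => rw [dotProduct_smul, hx, smul_zero]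
  have hpo : p - o ≠ 0 := by
    intro h
    have := ha p hp
    rw [h] at this
    simp at this
  have e2 : vectorSpan ℝ S ⊓ Submodule.span ℝ {p - o} = ⊥ := by
    rw [eq_bot_iff]
    rintro u ⟨h1, h2⟩
    obtain ⟨c, rfl⟩ := Submodule.mem_span_singleton.1 h2
    have := hz _ h1
    rw [dotProduct_smul, ha p hp] at this
    simp at this
    simp [this]
  have e3 := Submodule.finrank_sup_add_finrank_inf_eq (vectorSpan ℝ S) (Submodule.span ℝ {p - o})
  rw [e2, finrank_bot, finrank_span_singleton hpo, ← e1] at e3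
  simpa using e3

end PolyD


section PolyE
variable {d : ℕ}

def ctr (P : Set (Fin d → ℝ)) [Fintype (verts P)] : Fin d → ℝ :=
  ((Fintype.card (verts P) : ℝ))⁻¹ • ∑ v : verts P, v.1

def yy (P : Set (Fin d → ℝ)) [Fintype (verts P)] (v : verts P) : Fin d → ℝ := v.1 - ctr P

variable {P : Set (Fin d → ℝ)} [Fintype (verts P)]

lemma poly_hull (hP : IsPolytope P) : convexHull ℝ (verts P) = P :=
  hull_verts (poly_compact hP) (poly_convex hP) (verts_finite hP)

lemma verts_sub (v : verts P) : v.1 ∈ P := v.2.1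

lemma verts_nonempty (hP : IsPolytope P) (hdim : polyDim P = d) (hd : 0 < d) :
    (verts P).Nonempty := by
  by_contra h
  rw [Set.not_nonempty_iff_eq_empty] at h
  have h2 := polyDim_hull (verts P)
  rw [poly_hull hP, hdim, h, vectorSpan_empty, finrank_bot] at h2
  omega

lemma ctr_lt (hP : IsPolytope P) (hdim : polyDim P = d) (hd : 0 < d) (b : Fin d → ℝ) (c : ℝ)
    (hb : b ≠ 0) (hc : ∀ x ∈ P, b ⬝ᵥ x ≤ c) : b ⬝ᵥ ctr P < c := by
  obtain ⟨v0, hv0⟩ := verts_nonempty hP hdim hd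
  have hpos : (0 : ℝ) < Fintype.card (verts P) := by
    have : 0 < Fintype.card (verts P) := Fintype.card_pos_iff.2 ⟨⟨v0, hv0⟩⟩
    exact_mod_cast this
  have hex : ∃ v : verts P, b ⬝ᵥ v.1 < c := by
    by_contra hcon
    push Not at hcon
    have heq : ∀ v : verts P, b ⬝ᵥ v.1 = c := fun v => le_antisymm (hc _ v.2.1) (hcon v)
    have h2 := polyDim_hull (verts P)
    rw [poly_hull hP, hdim] at h2
    have htop : vectorSpan ℝ (verts P) = ⊤ := by
      apply Submodule.eq_top_of_finrank_eq
      rw [← h2]; simp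
    have hv := vectorSpan_eq_span_vsub_set_right ℝ hv0
    have hz : ∀ u ∈ vectorSpan ℝ (verts P), b ⬝ᵥ u = 0 := by
      intro u hu
      rw [hv] at hu
      induction hu using Submodule.span_induction with
      | mem x hx =>
        obtain ⟨w, hw, rfl⟩ := hx
        simp only [vsub_eq_sub]
        rw [dotProduct_sub, heq ⟨w, hw⟩, heq ⟨v0, hv0⟩, sub_self]
      | zero => simp
      | add x y _ _ hx hy => rw [dotProduct_add, hx, hy, add_zero]
      | smul c x _ hx => rw [dotProduct_smul, hx, smul_zero]
    have := hz b (by rw [htop]; trivial)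
    exact hb (dotProduct_self_eq_zero.1 this)
  have hs : ∑ v : verts P, b ⬝ᵥ v.1 < ∑ v : verts P, c := by
    apply Finset.sum_lt_sum (fun v _ => hc _ v.2.1)
    obtain ⟨v, hv⟩ := hex
    exact ⟨v, Finset.mem_univ _, hv⟩
  unfold ctr
  rw [dotProduct_smul, dotProduct_sum, smul_eq_mul, inv_mul_lt_iff₀ hpos]
  simpa using hs

lemma pol_iff (hP : IsPolytope P) (a : Fin d → ℝ) :
    Pol (yy P) a ↔ ∀ x ∈ P, a ⬝ᵥ (x - ctr P) ≤ 1 := by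
  constructor
  · intro h
    have h2 : convexHull ℝ (verts P) ⊆ {x | a ⬝ᵥ (x - ctr P) ≤ 1} := by
      apply convexHull_min
      · intro x hx
        exact h ⟨x, hx⟩
      · intro x hx z hz s t hs ht hst
        have : s • x + t • z - ctr P = s • (x - ctr P) + t • (z - ctr P) := by
          have : ctr P = s • ctr P + t • ctr P := by rw [← add_smul, hst, one_smul]
          nth_rewrite 1 [this]
          module
        have hx' : a ⬝ᵥ (x - ctr P) ≤ 1 := hx
        have hz' : a ⬝ᵥ (z - ctr P) ≤ 1 := hz
        change a ⬝ᵥ (s • x + t • z - ctr P) ≤ 1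
        rw [this, dotProduct_add, dotProduct_smul, dotProduct_smul, smul_eq_mul, smul_eq_mul]
        nlinarith
    rw [poly_hull hP] at h2
    exact h2
  · intro h v
    exact h _ v.2.1

lemma face_of (hP : IsPolytope P) (hdim : polyDim P = d) (hd : 0 < d) (H : Set (Fin d → ℝ))
    (hH : IsFaceOf P H) (hne : H.Nonempty) (hnP : H ≠ P) :
    ∃ a, Pol (yy P) a ∧ H = face P (ctr P) a := by
  rcases hH with h | h | ⟨b, c, hb, hc, rfl⟩
  · exact absurd h hne.ne_empty
  · exact absurd h hnP
  have hlt := ctr_lt hP hdim hd b c hb hc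
  have hp : 0 < c - b ⬝ᵥ ctr P := by linarith
  refine ⟨(c - b ⬝ᵥ ctr P)⁻¹ • b, ?_, ?_⟩
  · rw [pol_iff hP]
    intro x hx
    have : b ⬝ᵥ x ≤ c := hc x hx
    rw [smul_dotProduct, smul_eq_mul, inv_mul_le_iff₀ hp, dotProduct_sub]
    linarith
  · ext x
    apply and_congr_right
    intro hx
    rw [smul_dotProduct, smul_eq_mul, inv_mul_eq_iff_eq_mul₀ hp.ne', dotProduct_sub]
    change b ⬝ᵥ x = c ↔ _
    constructor <;> intro h <;> linarith

lemma isFace_face (hP : IsPolytope P) (a : Fin d → ℝ) (ha : Pol (yy P) a) :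
    IsFaceOf P (face P (ctr P) a) := by
  by_cases h0 : a = 0
  · left
    ext x
    simp [face, h0]
  right; right
  refine ⟨a, 1 + a ⬝ᵥ ctr P, h0, ?_, ?_⟩
  · intro x hx
    have := (pol_iff hP a).1 ha x hx
    rw [dotProduct_sub] at this
    change a ⬝ᵥ x ≤ _
    linarith
  · ext x
    apply and_congr_right
    intro hx
    rw [dotProduct_sub]
    change _ ↔ a ⬝ᵥ x = _
    constructor <;> intro h <;> linarith

variable [DecidableEq (verts P)]

lemma verts_face_eq (hP : IsPolytope P) (a : Fin d → ℝ) (ha : Pol (yy P) a) :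
    verts (face P (ctr P) a) = Subtype.val '' (Tt (yy P) a : Set (verts P)) := by
  rw [verts_face ((pol_iff hP a).1 ha)]
  ext x
  constructor
  · rintro ⟨h1, h2⟩
    exact ⟨⟨x, h2⟩, (mem_Tt _ _ _).2 h1.2, rfl⟩
  · rintro ⟨v, hv, rfl⟩
    exact ⟨⟨v.2.1, (mem_Tt (yy P) a v).1 hv⟩, v.2⟩

lemma verts_face_ncard (hP : IsPolytope P) (a : Fin d → ℝ) (ha : Pol (yy P) a) :
    (verts (face P (ctr P) a)).ncard = (Tt (yy P) a).card := by
  rw [verts_face_eq hP a ha, Set.ncard_image_of_injective _ Subtype.val_injective,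
    Set.ncard_coe_finset]

lemma face_nonempty (hP : IsPolytope P) (a : Fin d → ℝ) (ha : Pol (yy P) a) :
    (face P (ctr P) a).Nonempty ↔ (Tt (yy P) a).Nonempty := by
  rw [← face_hull hP ((pol_iff hP a).1 ha), convexHull_nonempty_iff, verts_face_eq hP a ha]
  simp

lemma face_eq_of_Tt (hP : IsPolytope P) (a b : Fin d → ℝ) (ha : Pol (yy P) a)
    (hb : Pol (yy P) b) : face P (ctr P) a = face P (ctr P) b ↔ Tt (yy P) a = Tt (yy P) b := by
  constructor
  · intro h
    have h2 := congrArg verts h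
    rw [verts_face_eq hP a ha, verts_face_eq hP b hb] at h2
    exact Finset.coe_injective (Subtype.val_injective.image_injective h2)
  · intro h
    rw [← face_hull hP ((pol_iff hP a).1 ha), ← face_hull hP ((pol_iff hP b).1 hb),
      verts_face_eq hP a ha, verts_face_eq hP b hb, h]

lemma polyDim_face (hP : IsPolytope P) (a : Fin d → ℝ) (ha : Pol (yy P) a)
    (hne : (Tt (yy P) a).Nonempty) :
    polyDim (face P (ctr P) a) + 1 =
      Module.finrank ℝ (Submodule.span ℝ (yy P '' (Tt (yy P) a : Set (verts P)))) := by
  have h1 := rank_one (Subtype.val '' (Tt (yy P) a : Set (verts P))) (by simpa using hne)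
    (ctr P) a (by rintro _ ⟨v, hv, rfl⟩; exact (mem_Tt (yy P) a v).1 hv)
  rw [Set.image_image] at h1
  rw [← face_hull hP ((pol_iff hP a).1 ha), polyDim_hull, verts_face_eq hP a ha, ← h1]
  rfl

lemma Sp_iff_dim (hP : IsPolytope P) (a : Fin d → ℝ) (ha : Pol (yy P) a)
    (hne : (Tt (yy P) a).Nonempty) (hd : 0 < d) :
    Sp (yy P) (Tt (yy P) a) ↔ polyDim (face P (ctr P) a) = d - 1 := by
  have h := polyDim_face hP a ha hne
  rw [Sp_iff]
  constructor
  · intro h2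
    rw [h2] at h
    simp at h
    omega
  · intro h2
    apply Submodule.eq_top_of_finrank_eq
    rw [← h]
    simp
    omega

lemma Tt_ne_of_Sp (hd : 0 < d) (a : Fin d → ℝ) (h : Sp (yy P) (Tt (yy P) a)) :
    (Tt (yy P) a).Nonempty := by
  by_contra hc
  rw [Finset.not_nonempty_iff_eq_empty] at hc
  rw [hc] at h
  have := h (fun _ => 1) (by simp)
  have := congrFun this ⟨0, hd⟩
  simp at this

lemma exGeo (hd : 0 < d) {F : Set (Fin d → ℝ)} (hPF : IsASPPair P F) :
    ∃ Γ : Geo (verts P) d, Γ.y = yy P ∧ F = face P (ctr P) Γ.aF := by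
  obtain ⟨hP, hdim, hF, hs⟩ := hPF
  have hFP : F ≠ P := by
    rintro rfl
    have := hF.2.2
    omega
  obtain ⟨aF, h1, h2⟩ := face_of hP hdim hd F hF.1 hF.2.1 hFP
  have hneF : (Tt (yy P) aF).Nonempty := by
    rw [← face_nonempty hP aF h1, ← h2]; exact hF.2.1
  have hsp : Sp (yy P) (Tt (yy P) aF) := by
    rw [Sp_iff_dim hP aF h1 hneF hd, ← h2]; exact hF.2.2
  refine ⟨{ y := yy P, H0 := ?_, aF := aF, polF := h1, spF := hsp, hcard := ?_, hd := hd }, rfl, h2⟩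
  · intro u hu
    by_contra hc
    push Not at hc
    have hpol : ∀ t : ℝ, 0 ≤ t → Pol (yy P) (t • u) := by
      intro t ht v
      rw [smul_dotProduct, smul_eq_mul]
      have := hc v
      nlinarith
    have hle : ∀ x ∈ P, u ⬝ᵥ x ≤ u ⬝ᵥ ctr P := by
      intro x hx
      by_contra hlt
      push Not at hlt
      have hp : 0 < u ⬝ᵥ x - u ⬝ᵥ ctr P := by linarith
      have := (pol_iff hP _).1 (hpol (2 * (u ⬝ᵥ x - u ⬝ᵥ ctr P)⁻¹) (by positivity)) x hx
      rw [smul_dotProduct, smul_eq_mul, dotProduct_sub, mul_assoc, inv_mul_cancel₀ hp.ne'] at this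
      linarith
    exact lt_irrefl _ (ctr_lt hP hdim hd u _ hu hle)
  · intro a ha hsa hne
    have hna := Tt_ne_of_Sp hd a hsa
    rw [← verts_face_ncard hP a ha]
    apply hs
    · exact ⟨isFace_face hP a ha, (face_nonempty hP a ha).2 hna,
        (Sp_iff_dim hP a ha hna hd).1 hsa⟩
    · intro h
      rw [h2, face_eq_of_Tt hP a aF ha h1] at h
      apply hne
      rw [← sub_eq_zero]
      apply hsa
      intro v hv
      have hv2 := hv
      rw [h] at hv2
      rw [mem_Tt] at hv hv2
      rw [sub_dotProduct, hv, hv2, sub_self]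

lemma fVec_eq (hd : 0 < d) {F : Set (Fin d → ℝ)} (hPF : IsASPPair P F)
    (Γ : Geo (verts P) d) (hy : Γ.y = yy P) (hF : F = face P (ctr P) Γ.aF)
    (i : ℕ) (h1 : 1 ≤ i) (h2 : i < d) : fVec P (i - 1) = Γ.shell.f i := by
  classical
  obtain ⟨hP, hdim, hFf, hs⟩ := hPF
  have hdimσ : ∀ a, Pol (yy P) a → ∀ G ∈ Γ.fac, Tt (yy P) a ⊆ G → (Tt (yy P) a).Nonempty →
      polyDim (face P (ctr P) a) + 1 = (Tt (yy P) a).card := by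
    intro a ha G hG hsub hne
    rw [polyDim_face hP a ha hne]
    have hli := Γ.li G hG _ hsub
    rw [hy] at hli
    have := finrank_span_eq_card hli
    rw [Fintype.card_coe] at this
    rw [← this]
    have e : yy P '' (Tt (yy P) a : Set (verts P)) =
        Set.range (fun v : Tt (yy P) a => yy P v.1) := by
      ext x
      simp
    rw [e]
  unfold fVec Shell.f
  have hset : {H : Set (Fin d → ℝ) | IsFaceOf P H ∧ H.Nonempty ∧ polyDim H = i - 1} =
      (fun σ : Finset (verts P) => convexHull ℝ (Subtype.val '' (σ : Set (verts P)))) ''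
      ((Finset.univ.filter (fun σ : Finset (verts P) =>
        σ.card = i ∧ ∃ G ∈ Γ.shell.𝒢, σ ⊆ G) : Finset (Finset (verts P))) :
          Set (Finset (verts P))) := by
    ext H
    simp only [Set.mem_image, Finset.coe_filter, Finset.mem_univ, true_and]
    constructor
    · rintro ⟨hH, hne, hi⟩
      have hHP : H ≠ P := by
        rintro rfl
        omega
      obtain ⟨a, ha, rfl⟩ := face_of hP hdim hd H hH hne hHP
      have haF : a ≠ Γ.aF := by
        rintro rfl
        rw [← hF] at hi
        have := hFf.2.2
        omega
      have hTn := (face_nonempty hP a ha).1 hne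
      obtain ⟨a', hsub, hG, -⟩ := Γ.exfac a (by rw [hy]; exact ha) haF
      rw [hy] at hsub hG
      have := hdimσ a ha _ hG hsub hTn
      refine ⟨Tt (yy P) a, ⟨by omega, _, hG, hsub⟩, ?_⟩
      rw [← verts_face_eq hP a ha, face_hull hP ((pol_iff hP a).1 ha)]
    · rintro ⟨σ, ⟨hc, G, hG, hsub⟩, rfl⟩
      obtain ⟨a, ha, hT⟩ := Γ.subface G hG σ hsub
      rw [hy] at ha hT
      have hne : (Tt (yy P) a).Nonempty := by
        rw [hT, ← Finset.card_pos]; omega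
      have := hdimσ a ha G hG (by rw [hT]; exact hsub) hne
      rw [hT] at this
      rw [← hT, ← verts_face_eq hP a ha, face_hull hP ((pol_iff hP a).1 ha)]
      exact ⟨isFace_face hP a ha, (face_nonempty hP a ha).2 hne, by omega⟩
  rw [hset, Set.InjOn.ncard_image, Set.ncard_coe_finset]
  intro σ hσ τ hτ hst
  simp only [Finset.coe_filter, Finset.mem_univ, true_and] at hσ hτ
  obtain ⟨-, G, hG, hsub⟩ := hσ
  obtain ⟨-, G', hG', hsub'⟩ := hτ
  obtain ⟨a, ha, hT⟩ := Γ.subface G hG σ hsub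
  obtain ⟨b, hb, hT'⟩ := Γ.subface G' hG' τ hsub'
  rw [hy] at ha hT hb hT'
  rw [← hT, ← hT'] at hst ⊢
  rw [← face_eq_of_Tt hP a b ha hb]
  simp only [← verts_face_eq hP a ha, ← verts_face_eq hP b hb] at hst
  rwa [face_hull hP ((pol_iff hP a).1 ha), face_hull hP ((pol_iff hP b).1 hb)] at hst

end PolyE

/-- **UBT for ASP, lower h-range.** For an ASP-pair `(P,F)` with `P ∈ 𝒫(d,n,s)` and
`P' = ∂P − {F}`: `h_k(P') ≤ C(n−d−1+k, k)` for every `0 ≤ k ≤ ⌊(d−1)/2⌋`. -/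
theorem ubt_asp_lower_range (d n s : ℕ) (P F : Set (Fin d → ℝ)) (hPF : IsASPPair P F)
    (hn : (verts P).ncard = n) (hF : (verts F).ncard = d + s) :
    ∀ k : ℕ, k ≤ (d - 1) / 2 → hBall P (k : ℤ) ≤ ((n - d - 1 + k).choose k : ℤ) := by
  classical
  intro k hk
  rcases Nat.eq_zero_or_pos k with rfl | hk0
  · simp [hBall, fBall]
  have hd : 0 < d := by omega
  haveI : Fintype (verts P) := (verts_finite hPF.1).fintype
  obtain ⟨Γ, hy, hFf⟩ := exGeo hd hPF
  have h := Γ.shell.h_le k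
  have hcard : Fintype.card (verts P) = n := by
    rw [← hn, ← Nat.card_coe_set_eq, Nat.card_eq_fintype_card]
  rw [hcard] at h
  refine le_trans (le_of_eq ?_) h
  unfold hBall
  rw [if_pos ⟨by omega, by omega⟩]
  simp only [Int.toNat_natCast]
  apply Finset.sum_congr rfl
  intro i hi
  rw [Finset.mem_range] at hi
  congr 1
  unfold fBall
  split_ifs with h0 h1 h2
  · rw [h0, Γ.shell.f_zero]; rfl
  · omega
  · omega
  · rw [fVec_eq hd hPF Γ hy hFf i (by omega) (by omega)]

end

end ASP
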